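/- arXiv:2111.14601 — 2 statements merged into one kernel-verified Lean document; each statement's English description precedes it below -/
import Mathlib

section
/- Let μ ≥ 0, c₀ ≥ 0 and set η = μ²/4. Let u₋(t,x) = ∫₀^∞ m^{−μ}(t,x,y) p⁰(t,x,y) dy. Then for every t > 0 the homogeneous tempered fractional boundary condition ∫₀^t (∂u₋/∂s)(s,0) · Π̄_η(t−s) ds + (c₀ + μ/2) · u₋(t,0) = 0 holds, where (∂u₋/∂s)(s,0) denotes the time derivative of s ↦ u₋(s,0). -/
open MeasureTheory Real Filter

/-- The Gaussian heat kernel `g(t,z) = exp(-z^2/(4t))/sqrt(4*pi*t)`. -/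
noncomputable def g (t z : ℝ) : ℝ := Real.exp (-z ^ 2 / (4 * t)) / Real.sqrt (4 * Real.pi * t)

/-- The elastic Brownian kernel `p⁰(t,x,y)` with elastic coefficient `c₀`. -/
noncomputable def p0 (c₀ t x y : ℝ) : ℝ :=
  g t (x - y) - g t (x + y)
    + ∫ w in Set.Ioi (0 : ℝ), Real.exp (-c₀ * w) * ((w + x + y) / t) * g t (w + x + y)

/-- The drift factor `m^μ(t,x,y) = exp(-μ²t/4 - (μ/2)(x-y))`. -/
noncomputable def mKer (μ t x y : ℝ) : ℝ := Real.exp (-μ ^ 2 * t / 4 - μ / 2 * (x - y))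

/-- `u(t,x) = ∫₀^∞ m^μ(t,x,y) p⁰(t,x,y) dy`. -/
noncomputable def uFun (μ c₀ t x : ℝ) : ℝ :=
  ∫ y in Set.Ioi (0 : ℝ), mKer μ t x y * p0 c₀ t x y

/-- The tail `Π̄_η(z) = ∫_z^∞ e^{-ηs}/(2√π s^{3/2}) ds` of the tempered 1/2-stable
Lévy measure. -/
noncomputable def PiBar (η z : ℝ) : ℝ :=
  ∫ s in Set.Ioi z, Real.exp (-η * s) / (2 * Real.sqrt Real.pi * s ^ ((3 : ℝ) / 2))

/-- `u₋(t,x) = ∫₀^∞ m^{-μ}(t,x,y) p⁰(t,x,y) dy`, the negatively drifted case. -/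
noncomputable def uNeg (μ c₀ t x : ℝ) : ℝ :=
  ∫ y in Set.Ioi (0 : ℝ), mKer (-μ) t x y * p0 c₀ t x y

open Set

/-- Hitting density. -/
noncomputable def fk (t z : ℝ) : ℝ := z / t * g t z

noncomputable def fkz (t z : ℝ) : ℝ := (1 / t - z ^ 2 / (2 * t ^ 2)) * g t z

noncomputable def fkt (t z : ℝ) : ℝ := (z ^ 3 / (4 * t ^ 3) - 3 * z / (2 * t ^ 2)) * g t z

lemma hasDerivAt_g_z (t z : ℝ) (ht : 0 < t) : HasDerivAt (fun z => g t z) (-(z / (2 * t)) * g t z) z := by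
  unfold g
  have h1 : HasDerivAt (fun z : ℝ => -z ^ 2 / (4 * t)) (-(z / (2 * t))) z := by
    have := ((hasDerivAt_pow 2 z).neg).div_const (4 * t)
    refine HasDerivAt.congr_deriv this ?_
    push_cast
    field_simp
    ring
  refine HasDerivAt.congr_deriv ((h1.exp).div_const (√(4 * π * t))) ?_
  ring

lemma hasDerivAt_g_t (t z : ℝ) (ht : 0 < t) :
    HasDerivAt (fun t => g t z) ((z ^ 2 / (4 * t ^ 2) - 1 / (2 * t)) * g t z) t := by
  unfold g
  have h1 : HasDerivAt (fun t : ℝ => -z ^ 2 / (4 * t)) (z ^ 2 / (4 * t ^ 2)) t := by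
    have := (hasDerivAt_const t (-z ^ 2)).div ((hasDerivAt_id t).const_mul 4) (by simp; positivity)
    refine HasDerivAt.congr_deriv this ?_
    simp
    field_simp
  have h2 : HasDerivAt (fun t : ℝ => √(4 * π * t)) (4 * π / (2 * √(4 * π * t))) t := by
    have := ((hasDerivAt_id t).const_mul (4 * π)).sqrt (by simp; positivity)
    simpa using this
  have hs : 0 < √(4 * π * t) := by positivity
  have hsq : √(4 * π * t) ^ 2 = 4 * π * t := Real.sq_sqrt (by positivity)
  refine HasDerivAt.congr_deriv ((h1.exp).div h2 hs.ne') ?_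
  set S := √(4 * π * t) with hS
  clear_value S
  field_simp
  rw [hsq]
  ring

lemma hasDerivAt_fk_z (t z : ℝ) (ht : 0 < t) : HasDerivAt (fun z => fk t z) (fkz t z) z := by
  have := ((hasDerivAt_id z).div_const t).mul (hasDerivAt_g_z t z ht)
  unfold fk fkz
  refine HasDerivAt.congr_deriv this ?_
  simp
  field_simp
  ring

lemma hasDerivAt_fkz_z (t z : ℝ) (ht : 0 < t) : HasDerivAt (fun z => fkz t z) (fkt t z) z := by
  have := (((hasDerivAt_pow 2 z).div_const (2 * t ^ 2)).const_sub (1 / t)).mul (hasDerivAt_g_z t z ht)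
  unfold fkt fkz
  refine HasDerivAt.congr_deriv this ?_
  simp
  field_simp
  ring

lemma hasDerivAt_fk_t (t z : ℝ) (ht : 0 < t) : HasDerivAt (fun t => fk t z) (fkt t z) t := by
  have := ((hasDerivAt_const t z).div (hasDerivAt_id t) ht.ne').mul (hasDerivAt_g_t t z ht)
  unfold fkt fk
  refine HasDerivAt.congr_deriv this ?_
  simp
  field_simp
  ring

lemma g_pos (t z : ℝ) (ht : 0 < t) : 0 < g t z := by
  unfold g; positivity

lemma fk_nonneg (t z : ℝ) (ht : 0 ≤ t) (hz : 0 ≤ z) : 0 ≤ fk t z := by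
  unfold fk g; positivity

lemma measurable_fk : Measurable (fun p : ℝ × ℝ => fk p.1 p.2) := by
  unfold fk g
  fun_prop

lemma int_mono (b : ℝ) (hb : 0 < b) (n : ℕ) : Integrable (fun z : ℝ => z ^ n * rexp (-b * z ^ 2)) := by
  have := integrable_rpow_mul_exp_neg_mul_sq hb (s := n) (by have := n.cast_nonneg (α := ℝ); linarith)
  simpa using this

lemma int_poly (b : ℝ) (hb : 0 < b) (C : ℝ) :
    Integrable (fun z : ℝ => C * (1 + z) ^ 4 * rexp (-b * z ^ 2)) := by
  have := ((((int_mono b hb 0).add ((int_mono b hb 1).const_mul 4)).add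
    ((int_mono b hb 2).const_mul 6)).add ((int_mono b hb 3).const_mul 4)).add (int_mono b hb 4)
  convert this.const_mul C using 2
  simp only [Pi.add_apply]
  ring

/-- polynomially bounded times g is integrable -/
lemma int_bdd (t : ℝ) (ht : 0 < t) (C : ℝ) (φ : ℝ → ℝ) (hφ : Measurable φ)
    (hb : ∀ z, 0 ≤ z → |φ z| ≤ C * (1 + z) ^ 4) : IntegrableOn (fun z => φ z * g t z) (Ioi 0) := by
  have h := (int_poly (1 / (4 * t)) (by positivity) (C / √(4 * π * t))).integrableOn (s := Ioi 0)
  refine Integrable.mono' h (by unfold g; fun_prop) ?_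
  refine (ae_restrict_iff' measurableSet_Ioi).2 (Eventually.of_forall fun z hz => ?_)
  rw [norm_mul, norm_eq_abs, norm_eq_abs, abs_of_pos (g_pos t z ht)]
  calc |φ z| * g t z ≤ C * (1 + z) ^ 4 * g t z := by
        gcongr
        · exact (g_pos t z ht).le
        · exact hb z (le_of_lt hz)
    _ = _ := by
        unfold g
        rw [show -z ^ 2 / (4 * t) = -(1 / (4 * t)) * z ^ 2 by ring]
        ring

/-- weights of linear growth -/
structure Wt (W W1 W2 : ℝ → ℝ) (C : ℝ) : Prop where
  d0 : ∀ z, HasDerivAt W (W1 z) z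
  d1 : ∀ z, HasDerivAt W1 (W2 z) z
  b0 : ∀ z, 0 ≤ z → |W z| ≤ C * (1 + z)
  b1 : ∀ z, 0 ≤ z → |W1 z| ≤ C * (1 + z)
  b2 : ∀ z, 0 ≤ z → |W2 z| ≤ C * (1 + z)
  m2 : Measurable W2

lemma int_fk (t : ℝ) (ht : 0 < t) (C : ℝ) (hC : 0 ≤ C) (φ : ℝ → ℝ) (hφ : Measurable φ)
    (hb : ∀ z, 0 ≤ z → |φ z| ≤ C * (1 + z)) : IntegrableOn (fun z => φ z * fk t z) (Ioi 0) := by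
  have := int_bdd t ht (C / t) (fun z => φ z * (z / t)) (by fun_prop) (fun z hz => by
    rw [abs_mul, abs_of_nonneg (by positivity : 0 ≤ z / t)]
    calc |φ z| * (z / t) ≤ (C * (1 + z)) * (z / t) := by gcongr; exact hb z hz
      _ = C / t * ((1 + z) * z) := by ring
      _ ≤ C / t * (1 + z) ^ 4 := by
        gcongr
        nlinarith [pow_nonneg hz 2, pow_nonneg hz 3, pow_nonneg hz 4])
  refine this.congr_fun (fun z _ => ?_) measurableSet_Ioi
  simp only [fk]; ring

lemma int_fkz (t : ℝ) (ht : 0 < t) (C : ℝ) (hC : 0 ≤ C) (φ : ℝ → ℝ) (hφ : Measurable φ)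
    (hb : ∀ z, 0 ≤ z → |φ z| ≤ C * (1 + z)) : IntegrableOn (fun z => φ z * fkz t z) (Ioi 0) := by
  have := int_bdd t ht (C * (1 / t + 1 / (2 * t ^ 2))) (fun z => φ z * (1 / t - z ^ 2 / (2 * t ^ 2)))
    (by fun_prop) (fun z hz => by
    rw [abs_mul]
    calc |φ z| * |1 / t - z ^ 2 / (2 * t ^ 2)| ≤ (C * (1 + z)) * (1 / t + z ^ 2 / (2 * t ^ 2)) := by
          gcongr
          · exact hb z hz
          · refine (abs_sub _ _).trans ?_
            rw [abs_of_nonneg (by positivity), abs_of_nonneg (by positivity)]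
      _ = C * (1 / t * (1 + z) + 1 / (2 * t ^ 2) * (z ^ 2 * (1 + z))) := by ring
      _ ≤ C * (1 / t * (1 + z) ^ 4 + 1 / (2 * t ^ 2) * (1 + z) ^ 4) := by
        gcongr
        all_goals nlinarith [pow_nonneg hz 2, pow_nonneg hz 3, pow_nonneg hz 4]
      _ = _ := by ring)
  refine this.congr_fun (fun z _ => ?_) measurableSet_Ioi
  simp only [fkz]; ring

lemma poly_fkt (t C z w : ℝ) (ht : 0 < t) (hC : 0 ≤ C) (hz : 0 ≤ z) (hw : |w| ≤ C * (1 + z)) :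
    |w * (z ^ 3 / (4 * t ^ 3) - 3 * z / (2 * t ^ 2))| ≤
      (C * (1 / (4 * t ^ 3) + 3 / (2 * t ^ 2))) * (1 + z) ^ 4 := by
    rw [abs_mul]
    calc |w| * |z ^ 3 / (4 * t ^ 3) - 3 * z / (2 * t ^ 2)|
        ≤ (C * (1 + z)) * (z ^ 3 / (4 * t ^ 3) + 3 * z / (2 * t ^ 2)) := by
          gcongr
          refine (abs_sub _ _).trans ?_
          rw [abs_of_nonneg (by positivity), abs_of_nonneg (by positivity)]
      _ = C * (1 / (4 * t ^ 3) * (z ^ 3 * (1 + z)) + 3 / (2 * t ^ 2) * (z * (1 + z))) := by ring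
      _ ≤ C * (1 / (4 * t ^ 3) * (1 + z) ^ 4 + 3 / (2 * t ^ 2) * (1 + z) ^ 4) := by
        gcongr
        all_goals nlinarith [pow_nonneg hz 2, pow_nonneg hz 3, pow_nonneg hz 4]
      _ = _ := by ring

lemma int_fkt (t : ℝ) (ht : 0 < t) (C : ℝ) (hC : 0 ≤ C) (φ : ℝ → ℝ) (hφ : Measurable φ)
    (hb : ∀ z, 0 ≤ z → |φ z| ≤ C * (1 + z)) : IntegrableOn (fun z => φ z * fkt t z) (Ioi 0) := by
  have := int_bdd t ht _ (fun z => φ z * (z ^ 3 / (4 * t ^ 3) - 3 * z / (2 * t ^ 2)))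
    (by fun_prop) (fun z hz => poly_fkt t C z _ ht hC hz (hb z hz))
  refine this.congr_fun (fun z _ => ?_) measurableSet_Ioi
  simp only [fkt]; ring

lemma ibp {W W1 W2 : ℝ → ℝ} {C : ℝ} (h : Wt W W1 W2 C) (t : ℝ) (ht : 0 < t) :
    ∫ z in Ioi 0, W z * fkt t z = (∫ z in Ioi 0, W2 z * fk t z) - W 0 * (1 / t * g t 0) := by
  have hC : 0 ≤ C := by have := (abs_nonneg _).trans (h.b0 0 le_rfl); simpa using this
  have mW : Measurable W := (Differentiable.continuous fun z => (h.d0 z).differentiableAt).measurable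
  have mW1 : Measurable W1 := (Differentiable.continuous fun z => (h.d1 z).differentiableAt).measurable
  have i1 := int_fkt t ht C hC W mW h.b0
  have i2 := int_fk t ht C hC W2 h.m2 h.b2
  have i3 := (int_fkz t ht C hC W mW h.b0).sub (int_fk t ht C hC W1 mW1 h.b1)
  have hd : ∀ z, HasDerivAt (fun z => W z * fkz t z - W1 z * fk t z)
      (W z * fkt t z - W2 z * fk t z) z := fun z => by
    refine HasDerivAt.congr_deriv (((h.d0 z).mul (hasDerivAt_fkz_z t z ht)).sub ((h.d1 z).mul (hasDerivAt_fk_z t z ht))) ?_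
    ring
  have hlim := tendsto_zero_of_hasDerivAt_of_integrableOn_Ioi (a := 0) (fun z _ => hd z)
    (i1.sub i2) i3
  have := integral_Ioi_of_hasDerivAt_of_tendsto' (fun z _ => hd z) (i1.sub i2) hlim
  rw [integral_sub i1 i2] at this
  have h0 : W 0 * fkz t 0 - W1 0 * fk t 0 = W 0 * (1 / t * g t 0) := by simp [fkz, fk]
  rw [h0] at this
  linarith

lemma g_le (t0 t z : ℝ) (h0 : 0 < t0) (h1 : t0 / 2 < t) (h2 : t < 2 * t0) :
    g t z ≤ 2 * g (2 * t0) z := by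
  have ht : 0 < t := by linarith
  unfold g
  have : √(4 * π * (2 * t0)) ≤ 2 * √(4 * π * t) := by
    rw [show (2 : ℝ) = √4 by rw [show (4 : ℝ) = 2 ^ 2 by norm_num]; simp, ← Real.sqrt_mul (by norm_num)]
    apply Real.sqrt_le_sqrt
    rw [show √4 = (2 : ℝ) by rw [show (4 : ℝ) = 2 ^ 2 by norm_num]; simp]
    nlinarith [Real.pi_pos]
  rw [div_le_iff₀ (by positivity)]
  have e : rexp (-z ^ 2 / (4 * t)) ≤ rexp (-z ^ 2 / (4 * (2 * t0))) := by
    apply Real.exp_le_exp.2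
    rw [neg_div, neg_div]
    apply neg_le_neg
    gcongr
  calc _ ≤ _ := e
    _ = rexp (-z ^ 2 / (4 * (2 * t0))) / √(4 * π * (2 * t0)) * √(4 * π * (2 * t0)) := by field_simp
    _ ≤ rexp (-z ^ 2 / (4 * (2 * t0))) / √(4 * π * (2 * t0)) * (2 * √(4 * π * t)) := by gcongr
    _ = _ := by ring

lemma genderiv {W W1 W2 : ℝ → ℝ} {C : ℝ} (h : Wt W W1 W2 C) (t : ℝ) (ht : 0 < t) :
    HasDerivAt (fun t => ∫ z in Ioi 0, W z * fk t z)
      ((∫ z in Ioi 0, W2 z * fk t z) - W 0 * (1 / t * g t 0)) t := by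
  have hC : 0 ≤ C := by have := (abs_nonneg _).trans (h.b0 0 le_rfl); simpa using this
  have mW : Measurable W := (Differentiable.continuous fun z => (h.d0 z).differentiableAt).measurable
  rw [← ibp h t ht]
  set D := C * (1 / (4 * (t / 2) ^ 3) + 3 / (2 * (t / 2) ^ 2)) with hD
  have hbd : IntegrableOn (fun z => (2 * D * (1 + z) ^ 4) * g (2 * t) z) (Ioi 0) := by
    refine int_bdd (2 * t) (by positivity) (2 * D) _ (by fun_prop) fun z hz => ?_
    rw [abs_of_nonneg (by positivity)]
  refine (hasDerivAt_integral_of_dominated_loc_of_deriv_le (F := fun t z => W z * fk t z)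
    (F' := fun t z => W z * fkt t z) (s := Ioo (t / 2) (2 * t)) (bound := fun z => (2 * D * (1 + z) ^ 4) * g (2 * t) z)
    (Ioo_mem_nhds (by linarith) (by linarith)) ?_ (int_fk t ht C hC W mW h.b0)
    (int_fkt t ht C hC W mW h.b0).aestronglyMeasurable ?_ hbd ?_).2
  · exact Eventually.of_forall fun s => by unfold fk g; fun_prop
  · refine (ae_restrict_iff' measurableSet_Ioi).2 (Eventually.of_forall fun z hz s hs => ?_)
    have hz' : 0 ≤ z := le_of_lt hz
    have hs0 : 0 < s := by linarith [hs.1]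
    have hs1 := hs.1
    rw [norm_eq_abs, fkt, ← mul_assoc, abs_mul, abs_of_pos (g_pos s z hs0)]
    calc _ ≤ (C * (1 / (4 * s ^ 3) + 3 / (2 * s ^ 2))) * (1 + z) ^ 4 * (2 * g (2 * t) z) := by
          gcongr
          · exact (g_pos s z hs0).le
          · exact poly_fkt s C z _ hs0 hC hz' (h.b0 z hz')
          · exact g_le t s z ht hs.1 hs.2
      _ ≤ D * (1 + z) ^ 4 * (2 * g (2 * t) z) := by
          have := g_pos (2 * t) z (by positivity)
          rw [hD]
          gcongr
      _ = _ := by ring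
  · exact Eventually.of_forall fun z s hs =>
      (hasDerivAt_fk_t s z (by linarith [hs.1])).const_mul (W z)

lemma fk_le (t s w : ℝ) (hs : 0 < s) (hst : s ≤ t) (hw : 0 < w) : fk s w ≤ 32 * √t / w ^ 3 := by
  unfold fk g
  have e : rexp (-w ^ 2 / (4 * s)) ≤ 32 * s ^ 2 / w ^ 4 := by
    rw [neg_div, Real.exp_neg]
    have := Real.quadratic_le_exp_of_nonneg (x := w ^ 2 / (4 * s)) (by positivity)
    have h2 : (w ^ 2 / (4 * s)) ^ 2 / 2 ≤ rexp (w ^ 2 / (4 * s)) := by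
      have : 0 ≤ w ^ 2 / (4 * s) := by positivity
      linarith
    calc (rexp (w ^ 2 / (4 * s)))⁻¹ ≤ ((w ^ 2 / (4 * s)) ^ 2 / 2)⁻¹ := by gcongr
      _ = _ := by field_simp; norm_num
  have e2 : √s ≤ √(4 * π * s) := by
    apply Real.sqrt_le_sqrt
    nlinarith [Real.pi_gt_three]
  have hs' : 0 < √s := by positivity
  calc w / s * (rexp (-w ^ 2 / (4 * s)) / √(4 * π * s)) ≤ w / s * ((32 * s ^ 2 / w ^ 4) / √s) := by gcongr
    _ = 32 * √s / w ^ 3 := by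
      nth_rw 1 [show s = √s ^ 2 from (Real.sq_sqrt hs.le).symm]
      nth_rw 2 [show s = √s ^ 2 from (Real.sq_sqrt hs.le).symm]
      field_simp
    _ ≤ _ := by gcongr

lemma hasDerivAt_p (t w y s : ℝ) (hs : 0 < s) (hst : s < t) :
    HasDerivAt (fun s => (y * s - w * (t - s)) / √(s * (t - s)))
      (t * (y * s + w * (t - s)) / (2 * (s * (t - s)) * √(s * (t - s)))) s := by
  have hσ : 0 < s * (t - s) := mul_pos hs (by linarith)
  have h0 : HasDerivAt (fun s => s * (t - s)) (t - 2 * s) s := by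
    refine HasDerivAt.congr_deriv ((hasDerivAt_id s).mul ((hasDerivAt_id s).const_sub t)) ?_
    simp; ring
  have h1 : HasDerivAt (fun s => y * s - w * (t - s)) (y + w) s := by
    refine HasDerivAt.congr_deriv (((hasDerivAt_id s).const_mul y).sub
      (((hasDerivAt_id s).const_sub t).const_mul w)) ?_
    simp
  refine HasDerivAt.congr_deriv (h1.div (h0.sqrt hσ.ne') (by positivity)) ?_
  have hsq := Real.sq_sqrt hσ.le
  set S := √(s * (t - s)) with hS
  have hSp : 0 < S := by positivity
  have h3 : t - s ≠ 0 := by linarith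
  rw [hsq, ← hsq]
  field_simp
  rw [hsq]
  ring

lemma tendsto_p (t w y s₀ : ℝ) (l : Filter ℝ) (hl : l ≤ nhds s₀) (hl2 : ∀ᶠ s in l, 0 < s ∧ s < t)
    (h0 : s₀ * (t - s₀) = 0)
    (hp : 0 < y * s₀ - w * (t - s₀)) :
    Tendsto (fun s => (y * s - w * (t - s)) / √(s * (t - s))) l atTop := by
  have h1 : Tendsto (fun s => y * s - w * (t - s)) l (nhds (y * s₀ - w * (t - s₀))) :=
    (Continuous.tendsto (by fun_prop) s₀).mono_left hl
  have h2 : Tendsto (fun s => √(s * (t - s))) l (nhdsWithin 0 (Ioi 0)) := by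
    apply tendsto_nhdsWithin_of_tendsto_nhds_of_eventually_within
    · have : Tendsto (fun s => √(s * (t - s))) (nhds s₀) (nhds (√(s₀ * (t - s₀)))) :=
        Continuous.tendsto (by fun_prop) s₀
      rw [h0, Real.sqrt_zero] at this
      exact this.mono_left hl
    · filter_upwards [hl2] with s hs
      have : 0 < s * (t - s) := mul_pos hs.1 (by linarith [hs.2])
      exact Real.sqrt_pos.2 this
  simp_rw [div_eq_mul_inv]
  exact h1.pos_mul_atTop hp (h2.inv_tendsto_nhdsGT_zero)

noncomputable def Phi (t x : ℝ) : ℝ := ∫ ξ in (0:ℝ)..x, rexp (-(1 / (4 * t)) * ξ ^ 2)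

lemma hasDerivAt_Phi (t x : ℝ) : HasDerivAt (Phi t) (rexp (-(1 / (4 * t)) * x ^ 2)) x := by
  have hc : Continuous (fun ξ : ℝ => rexp (-(1 / (4 * t)) * ξ ^ 2)) := by fun_prop
  exact intervalIntegral.integral_hasDerivAt_right (hc.intervalIntegrable _ _)
    (hc.stronglyMeasurableAtFilter _ _) hc.continuousAt

lemma Phi_neg (t x : ℝ) : Phi t (-x) = - Phi t x := by
  unfold Phi
  have := intervalIntegral.integral_comp_neg (a := 0) (b := x) (fun ξ : ℝ => rexp (-(1 / (4 * t)) * ξ ^ 2))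
  simp only [neg_sq, neg_zero] at this
  rw [this, intervalIntegral.integral_symm]

lemma tendsto_Phi (t : ℝ) (ht : 0 < t) : Tendsto (Phi t) atTop (nhds (√(4 * π * t) / 2)) := by
  have := intervalIntegral_tendsto_integral_Ioi (f := fun ξ : ℝ => rexp (-(1 / (4 * t)) * ξ ^ 2)) 0
    ((integrable_exp_neg_mul_sq (b := 1 / (4 * t)) (by positivity)).integrableOn) tendsto_id
  rw [integral_gaussian_Ioi] at this
  rw [show 4 * π * t = π / (1 / (4 * t)) by field_simp]
  exact this

lemma fk_conv_int (t w y : ℝ) (hw : 0 < w) (hy : 0 < y) :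
    IntegrableOn (fun s => fk s w * fk (t - s) y) (Ioo 0 t) := by
  refine Measure.integrableOn_of_bounded (M := (32 * √t / w ^ 3) * (32 * √t / y ^ 3)) (by simp) (by unfold fk g; fun_prop) ?_
  refine (ae_restrict_iff' measurableSet_Ioo).2 (Eventually.of_forall fun s hs => ?_)
  have h1 := fk_nonneg s w hs.1.le hw.le
  have h2 := fk_nonneg (t - s) y (by linarith [hs.2]) hy.le
  rw [norm_eq_abs, abs_of_nonneg (by positivity)]
  gcongr
  · exact fk_le t s w hs.1 hs.2.le hw
  · exact fk_le t (t - s) y (by linarith [hs.2]) (by linarith [hs.1]) hy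

lemma fk_conv (t w y : ℝ) (ht : 0 < t) (hw : 0 < w) (hy : 0 < y) :
    ∫ s in Ioo 0 t, fk s w * fk (t - s) y = fk t (w + y) := by
  have hi := fk_conv_int t w y hw hy
  rw [← integral_Ioc_eq_integral_Ioo, ← intervalIntegral.integral_of_le ht.le]
  have hi' : IntervalIntegrable (fun s => fk s w * fk (t - s) y) volume 0 t :=
    (intervalIntegrable_iff_integrableOn_Ioo_of_le ht.le).2 hi
  set A := 1 / (4 * π * t ^ 2) * rexp (-(w + y) ^ 2 / (4 * t)) with hA
  let P : ℝ → ℝ := fun s => (y * s - w * (t - s)) / √(s * (t - s))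
  let Q : ℝ → ℝ := fun s => (y * s - (-w) * (t - s)) / √(s * (t - s))
  have ev0 : ∀ᶠ s in nhdsWithin 0 (Ioi 0), 0 < s ∧ s < t := Ioo_mem_nhdsGT ht
  have evt : ∀ᶠ s in nhdsWithin t (Iio t), 0 < s ∧ s < t := Ioo_mem_nhdsLT ht
  have q0 : Tendsto (fun s => Phi t (Q s)) (nhdsWithin 0 (Ioi 0)) (nhds (√(4 * π * t) / 2)) :=
    (tendsto_Phi t ht).comp (tendsto_p t (-w) y 0 _ nhdsWithin_le_nhds ev0 (by simp) (by simp; positivity))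
  have qt : Tendsto (fun s => Phi t (Q s)) (nhdsWithin t (Iio t)) (nhds (√(4 * π * t) / 2)) :=
    (tendsto_Phi t ht).comp (tendsto_p t (-w) y t _ nhdsWithin_le_nhds evt (by simp) (by simp; positivity))
  have pt : Tendsto (fun s => Phi t (P s)) (nhdsWithin t (Iio t)) (nhds (√(4 * π * t) / 2)) :=
    (tendsto_Phi t ht).comp (tendsto_p t w y t _ nhdsWithin_le_nhds evt (by simp) (by simp; positivity))
  have p0' : Tendsto (fun s => Phi t (P s)) (nhdsWithin 0 (Ioi 0)) (nhds (-(√(4 * π * t) / 2))) := by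
    have := ((tendsto_Phi t ht).comp (tendsto_p t (-w) (-y) 0 _ nhdsWithin_le_nhds ev0 (by simp) (by simp; positivity))).neg
    refine this.congr fun s => ?_
    simp only [Function.comp, P]
    rw [← Phi_neg]
    congr 1
    ring
  have key := intervalIntegral.integral_eq_sub_of_hasDerivAt_of_tendsto ht
    (f := fun s => A * ((w + y) * Phi t (P s) + (w - y) * rexp (w * y / t) * Phi t (Q s)))
    (f' := fun s => fk s w * fk (t - s) y) ?_ hi'
    (((p0'.const_mul (w + y)).add (q0.const_mul ((w - y) * rexp (w * y / t)))).const_mul A)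
    (((pt.const_mul (w + y)).add (qt.const_mul ((w - y) * rexp (w * y / t)))).const_mul A)
  · rw [key, hA]
    unfold fk g
    have hsq : √(4 * π * t) ^ 2 = 4 * π * t := Real.sq_sqrt (by positivity)
    have hp : 0 < √(4 * π * t) := by positivity
    set S := √(4 * π * t) with hS
    have : 1 / (4 * π * t ^ 2) = 1 / (S ^ 2 * t) := by rw [hsq]; field_simp
    rw [this]
    clear_value S
    field_simp
    ring
  · intro s hs
    have hs1 : 0 < t - s := by linarith [hs.2]
    have hs0 := hs.1
    have hσ : 0 < s * (t - s) := mul_pos hs.1 hs1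
    have dP := (hasDerivAt_Phi t (P s)).comp s (hasDerivAt_p t w y s hs.1 hs.2)
    have dQ := (hasDerivAt_Phi t (Q s)).comp s (hasDerivAt_p t (-w) y s hs.1 hs.2)
    refine HasDerivAt.congr_deriv
      (((dP.const_mul (w + y)).add (dQ.const_mul ((w - y) * rexp (w * y / t)))).const_mul A) ?_
    have hsq := Real.sq_sqrt hσ.le
    have hS0 : √(4 * π * s) * √(4 * π * (t - s)) = 4 * π * √(s * (t - s)) := by
      rw [← Real.sqrt_mul (by positivity), show 4 * π * s * (4 * π * (t - s)) = (4 * π) ^ 2 * (s * (t - s)) by ring,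
        Real.sqrt_mul (by positivity), Real.sqrt_sq (by positivity)]
    have e1 : rexp (-(w + y) ^ 2 / (4 * t)) * rexp (-(1 / (4 * t)) * P s ^ 2)
        = rexp (-w ^ 2 / (4 * s)) * rexp (-y ^ 2 / (4 * (t - s))) := by
      rw [← Real.exp_add, ← Real.exp_add]
      congr 1
      simp only [P]
      rw [div_pow, hsq]
      field_simp
      ring
    have e2 : rexp (w * y / t) * rexp (-(1 / (4 * t)) * Q s ^ 2) = rexp (-(1 / (4 * t)) * P s ^ 2) := by
      rw [← Real.exp_add]
      congr 1
      simp only [P, Q]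
      rw [div_pow, div_pow, hsq]
      field_simp
      ring
    unfold fk g
    have hS : 0 < √(s * (t - s)) := by positivity
    calc _ = A * rexp (-(1 / (4 * t)) * P s ^ 2) * (w + y) * (t * (y * s + w * (t - s)) / (2 * (s * (t - s)) * √(s * (t - s))))
          + A * (rexp (w * y / t) * rexp (-(1 / (4 * t)) * Q s ^ 2)) * (w - y) * (t * (y * s + (-w) * (t - s)) / (2 * (s * (t - s)) * √(s * (t - s)))) := by
            ring
      _ = 1 / (4 * π * t ^ 2) * (rexp (-(w + y) ^ 2 / (4 * t)) * rexp (-(1 / (4 * t)) * P s ^ 2)) * (t * (w * y * t) / ((s * (t - s)) * √(s * (t - s)))) := by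
            rw [e2, hA]; field_simp; ring
      _ = w * y / (s * (t - s)) * (rexp (-w ^ 2 / (4 * s)) * rexp (-y ^ 2 / (4 * (t - s)))) / (4 * π * √(s * (t - s))) := by
            rw [e1]; field_simp
      _ = _ := by rw [← hS0]; field_simp

lemma exp_le_one_aux (a y : ℝ) (ha : 0 ≤ a) (hy : 0 ≤ y) : rexp (-a * y) ≤ 1 := by
  rw [Real.exp_le_one_iff]; nlinarith

lemma hasDerivAt_exp_aux (a z : ℝ) : HasDerivAt (fun z => rexp (-a * z)) (-a * rexp (-a * z)) z := by
  refine HasDerivAt.congr_deriv (((hasDerivAt_id z).const_mul (-a)).exp) ?_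
  simp; ring

lemma wt_exp (a : ℝ) (ha : 0 ≤ a) :
    Wt (fun z => rexp (-a * z)) (fun z => -a * rexp (-a * z)) (fun z => a ^ 2 * rexp (-a * z)) (1 + a + a ^ 2) where
  d0 := fun z => hasDerivAt_exp_aux a z
  d1 := fun z => by
    refine HasDerivAt.congr_deriv ((hasDerivAt_exp_aux a z).const_mul (-a)) ?_
    ring
  b0 := fun z hz => by
    have := exp_le_one_aux a z ha hz
    rw [abs_of_pos (by positivity)]
    nlinarith [mul_nonneg ha hz, mul_nonneg (sq_nonneg a) hz, sq_nonneg a]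
  b1 := fun z hz => by
    have := exp_le_one_aux a z ha hz
    rw [neg_mul, abs_neg, abs_of_nonneg (by positivity)]
    nlinarith [mul_nonneg ha hz, mul_nonneg (sq_nonneg a) hz, sq_nonneg a, mul_le_mul_of_nonneg_left this ha]
  b2 := fun z hz => by
    have := exp_le_one_aux a z ha hz
    rw [abs_of_nonneg (by positivity)]
    nlinarith [mul_nonneg ha hz, mul_nonneg (sq_nonneg a) hz, sq_nonneg a, mul_le_mul_of_nonneg_left this (sq_nonneg a)]
  m2 := by fun_prop

lemma int_exp_fk (a t : ℝ) (ha : 0 ≤ a) (ht : 0 < t) : IntegrableOn (fun z => rexp (-a * z) * fk t z) (Ioi 0) :=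
  int_fk t ht (1 + a + a ^ 2) (by positivity) _ (by fun_prop) (wt_exp a ha).b0

lemma integral_fk (t : ℝ) (ht : 0 < t) : ∫ z in Ioi 0, fk t z = 2 * g t 0 := by
  have i1 : IntegrableOn (fun z => fk t z) (Ioi 0) := by
    simpa using int_exp_fk 0 t le_rfl ht
  have i2 : IntegrableOn (fun z => -2 * g t z) (Ioi 0) :=
    int_bdd t ht 2 (fun _ => -2) (by fun_prop) fun z hz => by
      have : 1 ≤ (1 + z) ^ 4 := one_le_pow₀ (by linarith)
      simp; linarith
  have hd : ∀ z, HasDerivAt (fun z => -2 * g t z) (fk t z) z := fun z => by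
    refine HasDerivAt.congr_deriv ((hasDerivAt_g_z t z ht).const_mul (-2)) ?_
    unfold fk; field_simp
  have hlim := tendsto_zero_of_hasDerivAt_of_integrableOn_Ioi (a := 0) (fun z _ => hd z) i1 i2
  have := integral_Ioi_of_hasDerivAt_of_tendsto' (fun z _ => hd z) i1 hlim
  rw [this]; ring

lemma PiBar_eq (a z : ℝ) (ha : 0 ≤ a) (hz : 0 < z) :
    PiBar (a ^ 2) z = rexp (-a ^ 2 * z) * ∫ y in Ioi 0, rexp (-a * y) * fk z y := by
  have hd : ∀ t ∈ Ici z, HasDerivAt (fun t => rexp (-a ^ 2 * t) * ∫ y in Ioi 0, rexp (-a * y) * fk t y)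
      (-(rexp (-a ^ 2 * t) / (2 * √π * t ^ ((3 : ℝ) / 2)))) t := fun t ht => by
    have ht : 0 < t := lt_of_lt_of_le hz ht
    refine HasDerivAt.congr_deriv ((hasDerivAt_exp_aux (a ^ 2) t).mul (genderiv (wt_exp a ha) t ht)) ?_
    simp only [mul_assoc, integral_const_mul]
    have e : t ^ ((3 : ℝ) / 2) = t * √t := by
      rw [show (3 : ℝ) / 2 = 1 + 1 / 2 by norm_num, Real.rpow_add ht, Real.rpow_one, Real.sqrt_eq_rpow]
    have e2 : √(4 * (π * t)) = 2 * √π * √t := by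
      rw [Real.sqrt_mul (by norm_num), Real.sqrt_mul (by positivity), show (4 : ℝ) = 2 ^ 2 by norm_num, Real.sqrt_sq (by norm_num)]
      ring
    rw [e]
    simp only [g, mul_assoc] at *
    rw [e2]
    simp
    field_simp
    ring
  have hn : ∀ t ∈ Ioi z, -(rexp (-a ^ 2 * t) / (2 * √π * t ^ ((3 : ℝ) / 2))) ≤ 0 := fun t ht => by
    have ht : 0 < t := lt_trans hz ht
    have : 0 ≤ rexp (-a ^ 2 * t) / (2 * √π * t ^ ((3 : ℝ) / 2)) := by positivity
    linarith
  have hlim : Tendsto (fun t => rexp (-a ^ 2 * t) * ∫ y in Ioi 0, rexp (-a * y) * fk t y) atTop (nhds 0) := by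
    have h0 : Tendsto (fun t => 2 * g t 0) atTop (nhds 0) := by
      have h1 : Tendsto (fun t => √(4 * π * t)) atTop atTop :=
        Real.tendsto_sqrt_atTop.comp (tendsto_id.const_mul_atTop (by positivity))
      have := h1.inv_tendsto_atTop.const_mul 2
      simpa [g] using this
    refine squeeze_zero' ?_ ?_ h0
    · filter_upwards [eventually_gt_atTop 0] with t ht
      refine mul_nonneg (by positivity) (setIntegral_nonneg measurableSet_Ioi fun y hy => ?_)
      exact mul_nonneg (by positivity) (fk_nonneg t y ht.le (le_of_lt hy))
    · filter_upwards [eventually_gt_atTop 0] with t ht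
      rw [← integral_fk t ht]
      have h1 : ∫ y in Ioi 0, rexp (-a * y) * fk t y ≤ ∫ y in Ioi 0, fk t y := by
        refine setIntegral_mono_on (int_exp_fk a t ha ht) (by simpa using int_exp_fk 0 t le_rfl ht) measurableSet_Ioi fun y hy => ?_
        have hy : 0 ≤ y := le_of_lt hy
        have := mul_le_mul_of_nonneg_right (exp_le_one_aux a y ha hy) (fk_nonneg t y ht.le hy)
        linarith
      have h2 : 0 ≤ ∫ y in Ioi 0, rexp (-a * y) * fk t y :=
        setIntegral_nonneg measurableSet_Ioi fun y hy =>
          mul_nonneg (by positivity) (fk_nonneg t y ht.le (le_of_lt hy))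
      have h3 := exp_le_one_aux (a ^ 2) t (by positivity) ht.le
      nlinarith
  have := integral_Ioi_of_hasDerivAt_of_nonpos' hd hn hlim
  rw [integral_neg] at this
  unfold PiBar
  linarith

noncomputable def KK (a c z : ℝ) : ℝ := rexp (-a * z) * ∫ w in (0 : ℝ)..z, rexp (-(c - a) * w)

lemma KK_eq (a c z : ℝ) : KK a c z = ∫ w in (0 : ℝ)..z, rexp (-c * w) * rexp (-a * (z - w)) := by
  unfold KK
  rw [← intervalIntegral.integral_const_mul]
  congr 1
  ext w
  rw [← Real.exp_add, ← Real.exp_add]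
  ring_nf

lemma KK_nonneg (a c z : ℝ) (hz : 0 ≤ z) : 0 ≤ KK a c z := by
  unfold KK
  exact mul_nonneg (by positivity) (intervalIntegral.integral_nonneg hz fun _ _ => by positivity)

lemma KK_le (a c z : ℝ) (ha : 0 ≤ a) (hc : 0 ≤ c) (hz : 0 ≤ z) : KK a c z ≤ z := by
  rw [KK_eq]
  have : ∫ w in (0 : ℝ)..z, (1 : ℝ) = z := by simp
  conv_rhs => rw [← this]
  refine intervalIntegral.integral_mono_on hz (Continuous.intervalIntegrable (by fun_prop) _ _)
    (by simp) fun w hw => ?_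
  exact mul_le_one₀ (exp_le_one_aux c w hc hw.1) (by positivity) (exp_le_one_aux a _ ha (by linarith [hw.2]))

lemma hasDerivAt_KK (a c z : ℝ) : HasDerivAt (KK a c) (rexp (-c * z) - a * KK a c z) z := by
  have hc : Continuous (fun w : ℝ => rexp (-(c - a) * w)) := by fun_prop
  have := intervalIntegral.integral_hasDerivAt_right (hc.intervalIntegrable 0 z)
    (hc.stronglyMeasurableAtFilter _ _) hc.continuousAt
  refine HasDerivAt.congr_deriv ((hasDerivAt_exp_aux a z).mul this) ?_
  unfold KK
  rw [← Real.exp_add]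
  ring_nf

lemma wt_KK (a c : ℝ) (ha : 0 ≤ a) (hc : 0 ≤ c) :
    Wt (KK a c) (fun z => rexp (-c * z) - a * KK a c z)
      (fun z => a ^ 2 * KK a c z - (a + c) * rexp (-c * z)) (1 + a + a ^ 2 + c) where
  d0 := hasDerivAt_KK a c
  d1 := fun z => by
    refine HasDerivAt.congr_deriv ((hasDerivAt_exp_aux c z).sub ((hasDerivAt_KK a c z).const_mul a)) ?_
    ring
  b0 := fun z hz => by
    rw [abs_of_nonneg (KK_nonneg a c z hz)]
    have := KK_le a c z ha hc hz
    have : 0 ≤ (a + a ^ 2 + c) * (1 + z) := by positivity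
    linarith
  b1 := fun z hz => by
    have h1 := mul_le_mul_of_nonneg_left (KK_le a c z ha hc hz) ha
    have h2 := mul_nonneg ha (KK_nonneg a c z hz)
    have h3 := exp_le_one_aux c z hc hz
    have h4 : 0 < rexp (-c * z) := by positivity
    have h5 : 0 ≤ (a ^ 2 + c) * (1 + z) := by positivity
    rw [abs_le]; constructor <;> nlinarith
  b2 := fun z hz => by
    have h1 := mul_le_mul_of_nonneg_left (KK_le a c z ha hc hz) (sq_nonneg a)
    have h2 := mul_nonneg (sq_nonneg a) (KK_nonneg a c z hz)
    have h3 := mul_le_mul_of_nonneg_left (exp_le_one_aux c z hc hz) (by positivity : 0 ≤ a + c)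
    have h4 : 0 ≤ (a + c) * rexp (-c * z) := by positivity
    have h5 : 0 ≤ (a + c) * z := by positivity
    have h6 : 0 ≤ a ^ 2 := by positivity
    rw [abs_le]; constructor <;> nlinarith
  m2 := by
    have : Measurable (KK a c) :=
      (Differentiable.continuous fun z => (hasDerivAt_KK a c z).differentiableAt).measurable
    fun_prop

noncomputable def LL (a c t : ℝ) : ENNReal :=
  ∫⁻ w in Ioi 0, ∫⁻ y in Ioi 0, ENNReal.ofReal (rexp (-c * w) * rexp (-a * y) * fk t (w + y))

lemma meas_fk_comp {α : Type*} [MeasurableSpace α] {u v : α → ℝ} (hu : Measurable u) (hv : Measurable v) :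
    Measurable (fun x => fk (u x) (v x)) := measurable_fk.comp (hu.prodMk hv)

lemma int_shift (c t y : ℝ) (hc : 0 ≤ c) (ht : 0 < t) (hy : 0 ≤ y) :
    IntegrableOn (fun w => rexp (-c * w) * fk t (w + y)) (Ioi 0) := by
  have h := int_bdd t ht ((1 + y) / t) (fun w => (1 + y) / t * (1 + w) ^ 4) (by fun_prop) (fun w hw => by
    rw [abs_of_nonneg (by positivity)])
  refine Integrable.mono' h (by unfold fk g; fun_prop) ?_
  refine (ae_restrict_iff' measurableSet_Ioi).2 (Eventually.of_forall fun w hw => ?_)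
  have hw : 0 ≤ w := le_of_lt hw
  have hf := fk_nonneg t (w + y) ht.le (by positivity)
  rw [norm_eq_abs, abs_of_nonneg (by positivity)]
  have hg : g t (w + y) ≤ g t w := by
    unfold g
    gcongr
    linarith
  calc rexp (-c * w) * fk t (w + y) ≤ 1 * fk t (w + y) := by
        gcongr; exact exp_le_one_aux c w hc hw
    _ ≤ (w + y) / t * g t w := by unfold fk; rw [one_mul]; gcongr
    _ ≤ _ := by
      have := (g_pos t w ht).le
      gcongr
      rw [div_mul_eq_mul_div]
      gcongr
      have h1 : 1 + w ≤ (1 + w) ^ 4 := le_self_pow₀ (by linarith) (by norm_num)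
      nlinarith [mul_nonneg hw hy, mul_le_mul_of_nonneg_left h1 (by linarith : 0 ≤ 1 + y)]

lemma D_eq (a c t : ℝ) (hc : 0 ≤ c) (ht : 0 < t) :
    ∫ y in Ioi 0, rexp (-a * y) * ∫ w in Ioi 0, rexp (-c * w) * fk t (w + y) = (LL a c t).toReal := by
  have hm : StronglyMeasurable (fun y => ∫ w in Ioi 0, rexp (-c * w) * fk t (w + y)) := by
    apply StronglyMeasurable.integral_prod_right (f := fun y w => rexp (-c * w) * fk t (w + y))
    apply Measurable.stronglyMeasurable
    have := meas_fk_comp (α := ℝ × ℝ) (u := fun _ => t) (v := fun p => p.2 + p.1) (by fun_prop) (by fun_prop)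
    simp only [Function.uncurry_def]
    fun_prop
  have hnn : ∀ y ∈ Ioi (0:ℝ), ∀ w ∈ Ioi (0:ℝ), 0 ≤ rexp (-c * w) * fk t (w + y) := fun y hy w hw =>
    mul_nonneg (by positivity) (fk_nonneg _ _ ht.le (add_pos hw hy).le)
  rw [integral_eq_lintegral_of_nonneg_ae]
  · congr 1
    rw [LL, lintegral_lintegral_swap]
    · refine setLIntegral_congr_fun measurableSet_Ioi fun y hy => ?_
      try simp only
      rw [← integral_const_mul, ofReal_integral_eq_lintegral_ofReal]
      · congr 1; ext w; congr 1; ring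
      · exact (int_shift c t y hc ht (le_of_lt hy)).const_mul _
      · exact (ae_restrict_iff' measurableSet_Ioi).2 (Eventually.of_forall fun w hw =>
          mul_nonneg (by positivity) (hnn y hy w hw))
    · apply Measurable.aemeasurable
      have := meas_fk_comp (α := ℝ × ℝ) (u := fun _ => t) (v := fun p => p.1 + p.2) (by fun_prop) (by fun_prop)
      simp only [Function.uncurry_def]
      fun_prop
  · exact (ae_restrict_iff' measurableSet_Ioi).2 (Eventually.of_forall fun y hy =>
      mul_nonneg (by positivity) (setIntegral_nonneg measurableSet_Ioi (hnn y hy)))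
  · exact (((by fun_prop : Measurable fun y => rexp (-a * y)).stronglyMeasurable).mul hm).aestronglyMeasurable

lemma LL_eq (a c t : ℝ) (ht : 0 < t) :
    LL a c t = ∫⁻ z in Ioi 0, ENNReal.ofReal (KK a c z * fk t z) := by
  have hmf : Measurable (fun p : ℝ × ℝ => fk t p.2) := meas_fk_comp (by fun_prop) (by fun_prop)
  have step1 : ∀ w ∈ Ioi (0:ℝ), ∫⁻ y in Ioi 0, ENNReal.ofReal (rexp (-c * w) * rexp (-a * y) * fk t (w + y))
      = ∫⁻ z in Ioi 0, (Ioi w).indicator (fun z => ENNReal.ofReal (rexp (-c * w) * rexp (-a * (z - w)) * fk t z)) z := by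
    intro w hw
    rw [lintegral_indicator measurableSet_Ioi, Measure.restrict_restrict measurableSet_Ioi,
      inter_eq_left.2 (Ioi_subset_Ioi (le_of_lt hw)), ← lintegral_indicator measurableSet_Ioi,
      ← lintegral_indicator measurableSet_Ioi]
    conv_rhs => rw [← lintegral_add_right_eq_self _ w]
    congr 1; ext y
    by_cases hy : 0 < y
    · rw [indicator_of_mem (mem_Ioi.2 hy), indicator_of_mem (mem_Ioi.2 (by linarith))]
      rw [add_sub_cancel_right, add_comm w y]
    · rw [indicator_of_notMem (by simpa using hy), indicator_of_notMem (by simpa using hy)]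
  rw [LL, setLIntegral_congr_fun measurableSet_Ioi step1, lintegral_lintegral_swap]
  · refine setLIntegral_congr_fun measurableSet_Ioi fun z hz => ?_
    have hz : 0 < z := hz
    have : ∀ w : ℝ, (Ioi w).indicator (fun z => ENNReal.ofReal (rexp (-c * w) * rexp (-a * (z - w)) * fk t z)) z
      = (Iio z).indicator (fun w => ENNReal.ofReal (rexp (-c * w) * rexp (-a * (z - w)) * fk t z)) w := fun w => by
      simp [indicator]
    simp only [this]
    rw [lintegral_indicator measurableSet_Iio, Measure.restrict_restrict measurableSet_Iio, Iio_inter_Ioi,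
      KK_eq, intervalIntegral.integral_of_le hz.le, integral_Ioc_eq_integral_Ioo, ← integral_mul_const,
      ofReal_integral_eq_lintegral_ofReal]
    · refine Integrable.mul_const ?_ _
      refine IntegrableOn.mono_set (t := Icc 0 z) ?_ Ioo_subset_Icc_self
      exact Continuous.integrableOn_Icc (by fun_prop)
    · exact Eventually.of_forall fun w => mul_nonneg (by positivity) (fk_nonneg t z ht.le hz.le)
  · apply Measurable.aemeasurable
    have : (Function.uncurry fun w z => (Ioi w).indicator (fun z => ENNReal.ofReal (rexp (-c * w) * rexp (-a * (z - w)) * fk t z)) z)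
      = {p : ℝ × ℝ | p.1 < p.2}.indicator (fun p => ENNReal.ofReal (rexp (-c * p.1) * rexp (-a * (p.2 - p.1)) * fk t p.2)) := by
      ext p; simp [indicator, Function.uncurry]
    rw [this]
    refine Measurable.indicator (by fun_prop) (measurableSet_lt measurable_fst measurable_snd)

lemma D_eq_K (a c t : ℝ) (hc : 0 ≤ c) (ht : 0 < t) :
    ∫ y in Ioi 0, rexp (-a * y) * ∫ w in Ioi 0, rexp (-c * w) * fk t (w + y)
      = ∫ z in Ioi 0, KK a c z * fk t z := by
  rw [D_eq a c t hc ht, LL_eq a c t ht, integral_eq_lintegral_of_nonneg_ae]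
  · exact (ae_restrict_iff' measurableSet_Ioi).2 (Eventually.of_forall fun z hz =>
      mul_nonneg (KK_nonneg a c z (le_of_lt hz)) (fk_nonneg t z ht.le (le_of_lt hz)))
  · have : Measurable (KK a c) :=
      (Differentiable.continuous fun z => (hasDerivAt_KK a c z).differentiableAt).measurable
    have := meas_fk_comp (α := ℝ) (u := fun _ => t) (v := fun p => p) (by fun_prop) (by fun_prop)
    fun_prop

lemma meas_H (c : ℝ) : StronglyMeasurable (fun s => ∫ w in Ioi 0, rexp (-c * w) * fk s w) := by
  apply StronglyMeasurable.integral_prod_right (f := fun s w => rexp (-c * w) * fk s w)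
  apply Measurable.stronglyMeasurable
  have := measurable_fk
  simp only [Function.uncurry_def]
  fun_prop

lemma conv_eq (a c t : ℝ) (ha : 0 ≤ a) (hc : 0 ≤ c) (ht : 0 < t) :
    ∫ s in Ioo 0 t, (∫ w in Ioi 0, rexp (-c * w) * fk s w) * (∫ y in Ioi 0, rexp (-a * y) * fk (t - s) y)
      = (LL a c t).toReal := by
  have hnn : ∀ c s, 0 < s → ∀ w ∈ Ioi (0:ℝ), 0 ≤ rexp (-c * w) * fk s w := fun c s hs w hw =>
    mul_nonneg (by positivity) (fk_nonneg _ _ hs.le (le_of_lt hw))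
  have hL : ∀ c s, 0 ≤ c → 0 < s → ENNReal.ofReal (∫ w in Ioi 0, rexp (-c * w) * fk s w)
      = ∫⁻ w in Ioi 0, ENNReal.ofReal (rexp (-c * w) * fk s w) := fun c s hc hs =>
    ofReal_integral_eq_lintegral_ofReal (int_exp_fk c s hc hs)
      ((ae_restrict_iff' measurableSet_Ioi).2 (Eventually.of_forall (hnn c s hs)))
  have hm1 : ∀ {α : Type} [MeasurableSpace α] (u v x : α → ℝ), Measurable u → Measurable v → Measurable x →
      Measurable (fun q => ENNReal.ofReal (x q * fk (u q) (v q))) := fun u v x hu hv hx =>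
    (hx.mul (meas_fk_comp hu hv)).ennreal_ofReal
  rw [integral_eq_lintegral_of_nonneg_ae]
  · congr 1
    calc _ = ∫⁻ s in Ioo 0 t, ∫⁻ w in Ioi 0, ∫⁻ y in Ioi 0,
          ENNReal.ofReal (rexp (-c * w) * fk s w) * ENNReal.ofReal (rexp (-a * y) * fk (t - s) y) := by
          refine setLIntegral_congr_fun measurableSet_Ioo fun s hs => ?_
          have hs1 : 0 < t - s := by linarith [hs.2]
          try simp only
          rw [ENNReal.ofReal_mul (setIntegral_nonneg measurableSet_Ioi (hnn c s hs.1)),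
            hL c s hc hs.1, hL a _ ha hs1, ← lintegral_mul_const]
          · congr 1; ext w
            rw [lintegral_const_mul]
            exact hm1 _ _ _ (by fun_prop) (by fun_prop) (by fun_prop)
          · exact hm1 _ _ _ (by fun_prop) (by fun_prop) (by fun_prop)
      _ = ∫⁻ w in Ioi 0, ∫⁻ s in Ioo 0 t, ∫⁻ y in Ioi 0,
          ENNReal.ofReal (rexp (-c * w) * fk s w) * ENNReal.ofReal (rexp (-a * y) * fk (t - s) y) := by
          rw [lintegral_lintegral_swap]
          apply Measurable.aemeasurable
          apply Measurable.lintegral_prod_right' (f := fun q : (ℝ × ℝ) × ℝ =>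
            ENNReal.ofReal (rexp (-c * q.1.2) * fk q.1.1 q.1.2) * ENNReal.ofReal (rexp (-a * q.2) * fk (t - q.1.1) q.2))
          exact (hm1 _ _ _ (by fun_prop) (by fun_prop) (by fun_prop)).mul
            (hm1 _ _ _ (by fun_prop) (by fun_prop) (by fun_prop))
      _ = LL a c t := by
          unfold LL
          refine setLIntegral_congr_fun measurableSet_Ioi fun w hw => ?_
          try simp only
          rw [lintegral_lintegral_swap]
          · refine setLIntegral_congr_fun measurableSet_Ioi fun y hy => ?_
            try simp only
            rw [← fk_conv t w y ht hw hy, ← integral_const_mul, ofReal_integral_eq_lintegral_ofReal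
              ((fk_conv_int t w y hw hy).const_mul _)]
            · refine setLIntegral_congr_fun measurableSet_Ioo fun s hs => ?_
              try simp only
              rw [← ENNReal.ofReal_mul (hnn c s hs.1 w hw)]
              congr 1; ring
            · refine (ae_restrict_iff' measurableSet_Ioo).2 (Eventually.of_forall fun s hs => ?_)
              have h1 := fk_nonneg s w hs.1.le (le_of_lt hw)
              have h2 := fk_nonneg (t - s) y (by linarith [hs.2]) (le_of_lt hy)
              simp only [Pi.zero_apply]
              positivity
          · apply Measurable.aemeasurable
            exact (hm1 _ _ _ (by fun_prop) (by fun_prop) (by fun_prop)).mul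
              (hm1 _ _ _ (by fun_prop) (by fun_prop) (by fun_prop))
  · refine (ae_restrict_iff' measurableSet_Ioo).2 (Eventually.of_forall fun s hs => ?_)
    exact mul_nonneg (setIntegral_nonneg measurableSet_Ioi (hnn c s hs.1))
      (setIntegral_nonneg measurableSet_Ioi (hnn a (t - s) (by linarith [hs.2])))
  · exact ((meas_H c).mul ((meas_H a).comp_measurable (by fun_prop : Measurable fun s => t - s))).aestronglyMeasurable

lemma uNeg_eq (μ c t : ℝ) :
    uNeg μ c t 0 = rexp (-(μ / 2) ^ 2 * t) *
      ∫ y in Ioi 0, rexp (-(μ / 2) * y) * ∫ w in Ioi 0, rexp (-c * w) * fk t (w + y) := by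
  unfold uNeg
  rw [← integral_const_mul]
  congr 1; ext y
  have h1 : mKer (-μ) t 0 y = rexp (-(μ / 2) ^ 2 * t) * rexp (-(μ / 2) * y) := by
    unfold mKer
    rw [← Real.exp_add]
    ring_nf
  have h2 : p0 c t 0 y = ∫ w in Ioi 0, rexp (-c * w) * fk t (w + y) := by
    unfold p0
    have : g t (0 - y) = g t (0 + y) := by unfold g; simp
    rw [this, sub_self, zero_add]
    congr 1; ext w
    rw [fk, add_zero]; ring
  rw [h1, h2]; ring

lemma uNeg_deriv (μ c t : ℝ) (hμ : 0 ≤ μ) (hc : 0 ≤ c) (ht : 0 < t) :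
    deriv (fun τ => uNeg μ c τ 0) t =
      -(c + μ / 2) * (rexp (-(μ / 2) ^ 2 * t) * ∫ w in Ioi 0, rexp (-c * w) * fk t w) := by
  have ha : 0 ≤ μ / 2 := by positivity
  set a := μ / 2 with ha'
  have hW := wt_KK a c ha hc
  have h := (hasDerivAt_exp_aux (a ^ 2) t).mul (genderiv hW t ht)
  have hE : (fun τ => uNeg μ c τ 0) =ᶠ[nhds t]
      (fun t => rexp (-a ^ 2 * t)) * (fun t => ∫ z in Ioi 0, KK a c z * fk t z) := by
    filter_upwards [lt_mem_nhds ht] with s hs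
    rw [uNeg_eq, ← ha', D_eq_K a c s hc hs]; rfl
  rw [(h.congr_of_eventuallyEq hE).deriv]
  have hK0 : KK a c 0 = 0 := by simp [KK]
  have hmK : Measurable (KK a c) :=
      (Differentiable.continuous fun z => (hasDerivAt_KK a c z).differentiableAt).measurable
  have iK : IntegrableOn (fun z => KK a c z * fk t z) (Ioi 0) :=
    int_fk t ht (1 + a + a ^ 2 + c) (by positivity) _ hmK hW.b0
  have e : ∫ z in Ioi 0, (a ^ 2 * KK a c z - (a + c) * rexp (-c * z)) * fk t z
      = a ^ 2 * (∫ z in Ioi 0, KK a c z * fk t z) - (a + c) * ∫ z in Ioi 0, rexp (-c * z) * fk t z := by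
    rw [← integral_const_mul, ← integral_const_mul, ← integral_sub (iK.const_mul _) ((int_exp_fk c t hc ht).const_mul _)]
    congr 1; ext z; ring
  rw [e, hK0]
  ring

/-- the homogeneous tempered fractional boundary condition
`𝔇^{1/2,μ}_t u₋(t,0) + (c₀ + μ/2) u₋(t,0) = 0` for the negatively drifted elastic
Brownian motion. -/
theorem stmt2 (μ c₀ : ℝ) (hμ : 0 ≤ μ) (hc : 0 ≤ c₀) (t : ℝ) (ht : 0 < t) :
    (∫ s in (0 : ℝ)..t, deriv (fun τ => uNeg μ c₀ τ 0) s * PiBar (μ ^ 2 / 4) (t - s))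
      + (c₀ + μ / 2) * uNeg μ c₀ t 0 = 0 := by
  have ha : 0 ≤ μ / 2 := by positivity
  have key : ∫ s in Ioo 0 t, deriv (fun τ => uNeg μ c₀ τ 0) s * PiBar (μ ^ 2 / 4) (t - s)
      = ∫ s in Ioo 0 t, (-(c₀ + μ / 2) * rexp (-(μ / 2) ^ 2 * t)) *
        ((∫ w in Ioi 0, rexp (-c₀ * w) * fk s w) * (∫ y in Ioi 0, rexp (-(μ / 2) * y) * fk (t - s) y)) := by
    refine setIntegral_congr_fun measurableSet_Ioo fun s hs => ?_
    try simp only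
    rw [uNeg_deriv μ c₀ s hμ hc hs.1, show μ ^ 2 / 4 = (μ / 2) ^ 2 by ring,
      PiBar_eq _ _ ha (by linarith [hs.2]),
      show -(μ / 2) ^ 2 * t = -(μ / 2) ^ 2 * s + -(μ / 2) ^ 2 * (t - s) by ring, Real.exp_add]
    ring
  rw [intervalIntegral.integral_of_le ht.le, integral_Ioc_eq_integral_Ioo, key, integral_const_mul,
    conv_eq _ _ t ha hc ht, uNeg_eq, D_eq _ _ t hc ht]
  ring
end

section
/- Let μ ≥ 0, c₀ ≥ 0 and set η = μ²/4. Let u(t,x) = ∫₀^∞ m^μ(t,x,y) p⁰(t,x,y) dy. Then for every λ > 0 and x ≥ 0, ∫₀^∞ e^{−λt} u(t,x) dt = 1/λ − (1/λ) · (1 − (√(λ+η) + √η)/(c₀ + √(λ+η))) · e^{−x(√(λ+η) + √η)}. -/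
open MeasureTheory Real Filter

lemma ftc_Ioi (F f : ℝ → ℝ) (l m : ℝ) (hd : ∀ t ∈ Set.Ioi (0:ℝ), HasDerivAt F (f t) t)
    (hf : ∀ t ∈ Set.Ioi (0:ℝ), 0 ≤ f t)
    (hl : Tendsto F (nhdsWithin 0 (Set.Ioi 0)) (nhds l)) (hm : Tendsto F atTop (nhds m)) :
    IntegrableOn f (Set.Ioi 0) ∧ ∫ t in Set.Ioi (0:ℝ), f t = m - l := by
  have h1 : ContinuousWithinAt (Function.update F 0 l) (Set.Ici 0) 0 := by
    rw [continuousWithinAt_update_same]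
    simpa using hl
  have h2 : ∀ t ∈ Set.Ioi (0:ℝ), HasDerivAt (Function.update F 0 l) (f t) t := by
    intro t ht
    refine (hd t ht).congr_of_eventuallyEq ?_
    filter_upwards [isOpen_Ioi.mem_nhds ht] with u hu
    exact Function.update_of_ne (ne_of_gt hu) _ _
  have h3 : Tendsto (Function.update F 0 l) atTop (nhds m) := by
    refine hm.congr' ?_
    filter_upwards [eventually_gt_atTop (0:ℝ)] with u hu
    exact (Function.update_of_ne (ne_of_gt hu) _ _).symm
  have h4 := integrableOn_Ioi_deriv_of_nonneg h1 h2 hf h3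
  refine ⟨h4, ?_⟩
  rw [integral_Ioi_of_hasDerivAt_of_tendsto h1 h2 h4 h3]
  simp

noncomputable def PhiG (v : ℝ) : ℝ := ∫ r in (0:ℝ)..v, Real.exp (-1 * r ^ 2)

lemma PhiG_deriv (v : ℝ) : HasDerivAt PhiG (Real.exp (-1 * v ^ 2)) v := by
  have hc : Continuous (fun r : ℝ => Real.exp (-1 * r ^ 2)) := by fun_prop
  exact intervalIntegral.integral_hasDerivAt_right (hc.intervalIntegrable _ _)
    hc.aestronglyMeasurable.stronglyMeasurableAtFilter hc.continuousAt

lemma PhiG_top : Tendsto PhiG atTop (nhds (Real.sqrt Real.pi / 2)) := by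
  have h := intervalIntegral_tendsto_integral_Ioi (0:ℝ)
    (integrable_exp_neg_mul_sq (b := 1) one_pos).integrableOn tendsto_id
  rw [integral_gaussian_Ioi] at h
  simp only [div_one] at h
  exact h

lemma PhiG_neg (v : ℝ) : PhiG (-v) = - PhiG v := by
  unfold PhiG
  have := intervalIntegral.integral_comp_neg (a := 0) (b := v)
    (fun r : ℝ => Real.exp (-1 * r ^ 2))
  rw [intervalIntegral.integral_symm]
  simp only [neg_sq, neg_zero] at this
  rw [this]

lemma PhiG_bot : Tendsto PhiG atBot (nhds (-(Real.sqrt Real.pi / 2))) := by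
  have h := (PhiG_top.comp tendsto_neg_atBot_atTop).neg
  refine h.congr fun v => ?_
  simp [PhiG_neg]

lemma lap_aux (s z e : ℝ) (hs : 0 < s) (hz : 0 < z) (he : e = 1 ∨ e = -1) :
    IntegrableOn (fun t => Real.exp (-s ^ 2 * t) * Real.exp (-z ^ 2 / (4 * t)) *
      (s / (2 * √t) + z / (4 * t * √t) + e * (s / (2 * √t) - z / (4 * t * √t)))) (Set.Ioi 0) ∧
    ∫ t in Set.Ioi (0:ℝ), Real.exp (-s ^ 2 * t) * Real.exp (-z ^ 2 / (4 * t)) *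
      (s / (2 * √t) + z / (4 * t * √t) + e * (s / (2 * √t) - z / (4 * t * √t)))
      = √π * Real.exp (-s * z) := by
  have hsq0 : Tendsto (fun t : ℝ => √t) (nhdsWithin 0 (Set.Ioi 0)) (nhdsWithin 0 (Set.Ioi 0)) := by
    refine tendsto_nhdsWithin_iff.2 ⟨?_, ?_⟩
    · have : Tendsto (fun t : ℝ => √t) (nhds 0) (nhds (√0)) := Real.continuous_sqrt.tendsto 0
      rw [Real.sqrt_zero] at this
      exact this.mono_left nhdsWithin_le_nhds
    · filter_upwards [self_mem_nhdsWithin] with t ht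
      exact Real.sqrt_pos.2 ht
  have hinv0 : Tendsto (fun t : ℝ => z / (2 * √t)) (nhdsWithin 0 (Set.Ioi 0)) atTop := by
    have h := (tendsto_inv_nhdsGT_zero.comp hsq0).const_mul_atTop (half_pos hz)
    refine h.congr fun t => ?_
    simp only [Function.comp]; field_simp
  have hs0 : Tendsto (fun t : ℝ => s * √t) (nhdsWithin 0 (Set.Ioi 0)) (nhds 0) := by
    have h := (hsq0.mono_right nhdsWithin_le_nhds).const_mul s
    simpa using h
  have hsT : Tendsto (fun t : ℝ => s * √t) atTop atTop :=
    Real.tendsto_sqrt_atTop.const_mul_atTop hs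
  have hinvT : Tendsto (fun t : ℝ => z / (2 * √t)) atTop (nhds 0) := by
    have h := (tendsto_inv_atTop_zero.comp Real.tendsto_sqrt_atTop).const_mul (z/2)
    rw [mul_zero] at h
    refine h.congr fun t => ?_
    simp only [Function.comp]; field_simp
  have a0 : Tendsto (fun t : ℝ => s * √t - z / (2 * √t)) (nhdsWithin 0 (Set.Ioi 0)) atBot := by
    simp only [sub_eq_add_neg]
    exact hs0.add_atBot (tendsto_neg_atTop_atBot.comp hinv0)
  have b0 : Tendsto (fun t : ℝ => s * √t + z / (2 * √t)) (nhdsWithin 0 (Set.Ioi 0)) atTop :=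
    hs0.add_atTop hinv0
  have aT : Tendsto (fun t : ℝ => s * √t - z / (2 * √t)) atTop atTop := by
    simp only [sub_eq_add_neg]
    exact hsT.atTop_add hinvT.neg
  have bT : Tendsto (fun t : ℝ => s * √t + z / (2 * √t)) atTop atTop := hsT.atTop_add hinvT
  have key := ftc_Ioi (fun t => Real.exp (-s * z) * PhiG (s * √t - z / (2 * √t)) +
      e * (Real.exp (s * z) * PhiG (s * √t + z / (2 * √t))))
    (fun t => Real.exp (-s ^ 2 * t) * Real.exp (-z ^ 2 / (4 * t)) *
      (s / (2 * √t) + z / (4 * t * √t) + e * (s / (2 * √t) - z / (4 * t * √t))))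
    (Real.exp (-s * z) * (-(√π / 2)) + e * (Real.exp (s * z) * (√π / 2)))
    (Real.exp (-s * z) * (√π / 2) + e * (Real.exp (s * z) * (√π / 2))) ?_ ?_ ?_ ?_
  · refine ⟨key.1, key.2.trans (by ring)⟩
  · intro t ht
    have ht : 0 < t := ht
    have hr : 0 < √t := Real.sqrt_pos.2 ht
    have hrr : √t ^ 2 = t := Real.sq_sqrt ht.le
    have d1 : HasDerivAt (fun t : ℝ => √t) (1 / (2 * √t)) t := Real.hasDerivAt_sqrt ht.ne'
    have ds : HasDerivAt (fun t : ℝ => s * √t) (s / (2 * √t)) t := by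
      refine (d1.const_mul s).congr_deriv ?_; ring
    have di : HasDerivAt (fun t : ℝ => z / (2 * √t)) (- (z / (4 * t * √t))) t := by
      refine ((hasDerivAt_const t z).div (d1.const_mul 2) (by positivity)).congr_deriv ?_
      field_simp
      rw [hrr]; ring
    have da := (PhiG_deriv (s * √t - z / (2 * √t))).comp t (ds.sub di)
    have db := (PhiG_deriv (s * √t + z / (2 * √t))).comp t (ds.add di)
    have hfin := (da.const_mul (Real.exp (-s * z))).add ((db.const_mul (Real.exp (s * z))).const_mul e)
    refine hfin.congr_deriv ?_
    have e1 : Real.exp (-s * z) * Real.exp (-1 * (s * √t - z / (2 * √t)) ^ 2) =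
        Real.exp (-s ^ 2 * t) * Real.exp (-z ^ 2 / (4 * t)) := by
      rw [← Real.exp_add, ← Real.exp_add]
      congr 1
      have : -s ^ 2 * t + -z ^ 2 / (4 * t) = -s ^ 2 * √t ^ 2 + -z ^ 2 / (4 * √t ^ 2) := by rw [hrr]
      rw [this]; field_simp; ring
    have e2 : Real.exp (s * z) * Real.exp (-1 * (s * √t + z / (2 * √t)) ^ 2) =
        Real.exp (-s ^ 2 * t) * Real.exp (-z ^ 2 / (4 * t)) := by
      rw [← Real.exp_add, ← Real.exp_add]
      congr 1
      have : -s ^ 2 * t + -z ^ 2 / (4 * t) = -s ^ 2 * √t ^ 2 + -z ^ 2 / (4 * √t ^ 2) := by rw [hrr]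
      rw [this]; field_simp; ring
    linear_combination (s / (2 * √t) + z / (4 * t * √t)) * e1 +
      e * (s / (2 * √t) - z / (4 * t * √t)) * e2
  · intro t ht
    have ht : 0 < t := ht
    have hr : 0 < √t := Real.sqrt_pos.2 ht
    refine mul_nonneg (by positivity) ?_
    rcases he with rfl | rfl
    · have : s / (2 * √t) + z / (4 * t * √t) + 1 * (s / (2 * √t) - z / (4 * t * √t)) = s / √t := by
        field_simp; ring
      rw [this]; positivity
    · have : s / (2 * √t) + z / (4 * t * √t) + -1 * (s / (2 * √t) - z / (4 * t * √t))
        = z / (2 * t * √t) := by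
        field_simp; ring
      rw [this]; positivity
  · exact ((PhiG_bot.comp a0).const_mul _).add (((PhiG_top.comp b0).const_mul _).const_mul e)
  · exact ((PhiG_top.comp aT).const_mul _).add (((PhiG_top.comp bT).const_mul _).const_mul e)

lemma sqrt4 (t : ℝ) : √(4 * π * t) = 2 * √π * √t := by
  rw [Real.sqrt_mul (by positivity), Real.sqrt_mul (by norm_num)]
  congr 2
  rw [show (4:ℝ) = 2 ^ 2 by norm_num]; simp

lemma lapA (s z : ℝ) (hs : 0 < s) (hz : 0 < z) :
    IntegrableOn (fun t => Real.exp (-s ^ 2 * t) * g t z) (Set.Ioi 0) ∧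
    ∫ t in Set.Ioi (0:ℝ), Real.exp (-s ^ 2 * t) * g t z = Real.exp (-s * z) / (2 * s) := by
  obtain ⟨h1, h2⟩ := lap_aux s z 1 hs hz (Or.inl rfl)
  have hpi : 0 < √π := Real.sqrt_pos.2 Real.pi_pos
  have hE : ∀ t ∈ Set.Ioi (0:ℝ), (1 / (2 * √π * s)) * (Real.exp (-s ^ 2 * t) *
      Real.exp (-z ^ 2 / (4 * t)) *
      (s / (2 * √t) + z / (4 * t * √t) + 1 * (s / (2 * √t) - z / (4 * t * √t))))
      = Real.exp (-s ^ 2 * t) * g t z := by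
    intro t ht
    have hr : 0 < √t := Real.sqrt_pos.2 ht
    have : s / (2 * √t) + z / (4 * t * √t) + 1 * (s / (2 * √t) - z / (4 * t * √t)) = s / √t := by
      ring
    rw [this, g, sqrt4]
    field_simp
  refine ⟨IntegrableOn.congr_fun (h1.const_mul _) hE measurableSet_Ioi, ?_⟩
  rw [← setIntegral_congr_fun measurableSet_Ioi hE, integral_const_mul, h2]
  field_simp

lemma lapP (s z : ℝ) (hs : 0 < s) (hz : 0 < z) :
    IntegrableOn (fun t => Real.exp (-s ^ 2 * t) * (z / t * g t z)) (Set.Ioi 0) ∧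
    ∫ t in Set.Ioi (0:ℝ), Real.exp (-s ^ 2 * t) * (z / t * g t z) = Real.exp (-s * z) := by
  obtain ⟨h1, h2⟩ := lap_aux s z (-1) hs hz (Or.inr rfl)
  have hpi : 0 < √π := Real.sqrt_pos.2 Real.pi_pos
  have hE : ∀ t ∈ Set.Ioi (0:ℝ), (1 / √π) * (Real.exp (-s ^ 2 * t) *
      Real.exp (-z ^ 2 / (4 * t)) *
      (s / (2 * √t) + z / (4 * t * √t) + -1 * (s / (2 * √t) - z / (4 * t * √t))))
      = Real.exp (-s ^ 2 * t) * (z / t * g t z) := by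
    intro t ht
    have ht : 0 < t := ht
    have hr : 0 < √t := Real.sqrt_pos.2 ht
    have : s / (2 * √t) + z / (4 * t * √t) + -1 * (s / (2 * √t) - z / (4 * t * √t))
        = z / (2 * t * √t) := by
      ring
    rw [this, g, sqrt4]
    field_simp
  refine ⟨IntegrableOn.congr_fun (h1.const_mul _) hE measurableSet_Ioi, ?_⟩
  rw [← setIntegral_congr_fun measurableSet_Ioi hE, integral_const_mul, h2]
  field_simp

lemma prodInt (f : ℝ → ℝ → ℝ) (k : ℝ → ℝ) (hm : Measurable (Function.uncurry f))
    (hpos : ∀ t > 0, ∀ y > 0, 0 ≤ f t y)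
    (hint : ∀ᵐ y ∂(volume.restrict (Set.Ioi (0:ℝ))), IntegrableOn (fun t => f t y) (Set.Ioi 0) ∧
      ∫ t in Set.Ioi (0:ℝ), f t y = k y)
    (hk : IntegrableOn k (Set.Ioi 0)) :
    Integrable (Function.uncurry f)
      ((volume.restrict (Set.Ioi (0:ℝ))).prod (volume.restrict (Set.Ioi (0:ℝ)))) := by
  rw [integrable_prod_iff' hm.aestronglyMeasurable]
  refine ⟨hint.mono fun y hy => hy.1, ?_⟩
  refine Integrable.congr hk ?_
  filter_upwards [hint, ae_restrict_mem measurableSet_Ioi] with y hy hy0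
  rw [← hy.2]
  refine setIntegral_congr_fun measurableSet_Ioi fun t ht => ?_
  exact (Real.norm_of_nonneg (hpos t ht y hy0)).symm

lemma g_nonneg (t z : ℝ) : 0 ≤ g t z := by unfold g; positivity

lemma g_meas : Measurable (Function.uncurry g) := by
  unfold g Function.uncurry; fun_prop

lemma g_meas2 {α : Type*} [MeasurableSpace α] {a b : α → ℝ} (ha : Measurable a)
    (hb : Measurable b) : Measurable (fun p => g (a p) (b p)) := g_meas.comp (ha.prodMk hb)

lemma lapQ (s c₀ x y : ℝ) (hs : 0 < s) (hc : 0 ≤ c₀) (hx : 0 ≤ x) (hy : 0 < y) :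
    IntegrableOn (fun t => Real.exp (-s ^ 2 * t) * ∫ w in Set.Ioi (0 : ℝ),
      Real.exp (-c₀ * w) * ((w + x + y) / t) * g t (w + x + y)) (Set.Ioi 0) ∧
    ∫ t in Set.Ioi (0:ℝ), Real.exp (-s ^ 2 * t) * ∫ w in Set.Ioi (0 : ℝ),
      Real.exp (-c₀ * w) * ((w + x + y) / t) * g t (w + x + y)
      = Real.exp (-s * (x + y)) / (c₀ + s) := by
  have hneg : -(c₀ + s) < 0 := by linarith
  have hI : ∀ w > 0, IntegrableOn (fun t => Real.exp (-s ^ 2 * t) *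
        (Real.exp (-c₀ * w) * ((w + x + y) / t) * g t (w + x + y))) (Set.Ioi 0) ∧
      ∫ t in Set.Ioi (0:ℝ), Real.exp (-s ^ 2 * t) *
        (Real.exp (-c₀ * w) * ((w + x + y) / t) * g t (w + x + y)) =
        Real.exp (-s * (x + y)) * Real.exp (-(c₀ + s) * w) := by
    intro w hw
    obtain ⟨h1, h2⟩ := lapP s (w + x + y) hs (by linarith)
    have hE : ∀ t, Real.exp (-s ^ 2 * t) *
        (Real.exp (-c₀ * w) * ((w + x + y) / t) * g t (w + x + y)) =
        Real.exp (-c₀ * w) * (Real.exp (-s ^ 2 * t) * ((w + x + y) / t * g t (w + x + y))) := by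
      intro t; ring
    simp only [hE]
    refine ⟨h1.const_mul _, ?_⟩
    rw [integral_const_mul, h2, ← Real.exp_add, ← Real.exp_add]
    congr 1; ring
  have hprod := prodInt (fun t w => Real.exp (-s ^ 2 * t) *
        (Real.exp (-c₀ * w) * ((w + x + y) / t) * g t (w + x + y)))
      (fun w => Real.exp (-s * (x + y)) * Real.exp (-(c₀ + s) * w)) ?_ ?_ ?_ ?_
  · have e1 : ∀ t, ∫ w in Set.Ioi (0:ℝ), Real.exp (-s ^ 2 * t) *
        (Real.exp (-c₀ * w) * ((w + x + y) / t) * g t (w + x + y)) =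
        Real.exp (-s ^ 2 * t) * ∫ w in Set.Ioi (0 : ℝ),
          Real.exp (-c₀ * w) * ((w + x + y) / t) * g t (w + x + y) := fun t =>
      integral_const_mul _ _
    have h1 := hprod.integral_prod_left
    have h2 := integral_integral_swap hprod
    simp only [Function.uncurry, e1] at h1 h2
    refine ⟨h1, h2.trans ?_⟩
    rw [setIntegral_congr_fun measurableSet_Ioi (fun w hw => (hI w hw).2), integral_const_mul,
      integral_exp_mul_Ioi hneg]
    have : c₀ + s ≠ 0 := by linarith
    rw [mul_zero, Real.exp_zero, neg_div_neg_eq]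
    field_simp
  · have := g_meas2 (α := ℝ × ℝ) (a := fun p => p.1) (b := fun p => p.2 + x + y)
      (by fun_prop) (by fun_prop)
    unfold Function.uncurry
    fun_prop
  · intro t ht w hw
    have := g_nonneg t (w + x + y)
    positivity
  · filter_upwards [ae_restrict_mem measurableSet_Ioi] with w hw
    exact hI w hw
  · exact (integrableOn_exp_mul_Ioi hneg 0).const_mul _

lemma Q_meas (c₀ x : ℝ) : Measurable (fun p : ℝ × ℝ => ∫ w in Set.Ioi (0 : ℝ),
      Real.exp (-c₀ * w) * ((w + x + p.2) / p.1) * g p.1 (w + x + p.2)) := by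
  have : StronglyMeasurable (Function.uncurry fun (p : ℝ × ℝ) (w : ℝ) =>
      Real.exp (-c₀ * w) * ((w + x + p.2) / p.1) * g p.1 (w + x + p.2)) := by
    apply Measurable.stronglyMeasurable
    have := g_meas2 (α := (ℝ × ℝ) × ℝ) (a := fun p => p.1.1) (b := fun p => p.2 + x + p.1.2)
      (by fun_prop) (by fun_prop)
    unfold Function.uncurry
    fun_prop
  exact this.integral_prod_right.measurable

/-- the y-integral of the first Laplace-transformed piece -/
lemma kA (s h x : ℝ) (hh : 0 ≤ h) (hsh : h < s) (hx : 0 ≤ x) :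
    IntegrableOn (fun y => Real.exp (-h * (x - y)) * (Real.exp (-s * |x - y|) / (2 * s)))
      (Set.Ioi 0) ∧
    ∫ y in Set.Ioi (0:ℝ), Real.exp (-h * (x - y)) * (Real.exp (-s * |x - y|) / (2 * s)) =
      1 / (2 * s) * ((1 - Real.exp (-x * (s + h))) / (s + h) + 1 / (s - h)) := by
  have hs : 0 < s := by linarith
  have hneg : h - s < 0 := by linarith
  have hU : Set.Ioi (0:ℝ) = Set.Ioc 0 x ∪ Set.Ioi x := (Set.Ioc_union_Ioi_eq_Ioi hx).symm
  have c1 : ∀ y ∈ Set.Ioc 0 x, Real.exp (-(s + h) * x) / (2 * s) * Real.exp ((s + h) * y) =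
      Real.exp (-h * (x - y)) * (Real.exp (-s * |x - y|) / (2 * s)) := by
    intro y hy
    rw [abs_of_nonneg (by linarith [hy.2]), div_mul_eq_mul_div, ← Real.exp_add, ← mul_div_assoc,
      ← Real.exp_add]
    congr 2; ring
  have c2 : ∀ y ∈ Set.Ioi x, Real.exp ((s - h) * x) / (2 * s) * Real.exp ((h - s) * y) =
      Real.exp (-h * (x - y)) * (Real.exp (-s * |x - y|) / (2 * s)) := by
    intro y hy
    have hy : x < y := hy
    rw [abs_of_nonpos (by linarith), div_mul_eq_mul_div, ← Real.exp_add, ← mul_div_assoc,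
      ← Real.exp_add]
    congr 2; ring
  have hc : Continuous (fun y : ℝ => Real.exp (-(s + h) * x) / (2 * s) * Real.exp ((s + h) * y)) := by
    fun_prop
  have i1 := IntegrableOn.congr_fun
    ((hc.integrableOn_Icc (μ := volume) (a := 0) (b := x)).mono_set Set.Ioc_subset_Icc_self) c1 measurableSet_Ioc
  have i2 := IntegrableOn.congr_fun ((integrableOn_exp_mul_Ioi hneg x).const_mul _) c2
    measurableSet_Ioi
  rw [hU]
  refine ⟨i1.union i2, ?_⟩
  rw [setIntegral_union (Set.Ioc_disjoint_Ioi le_rfl) measurableSet_Ioi i1 i2,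
    ← setIntegral_congr_fun measurableSet_Ioc c1, ← setIntegral_congr_fun measurableSet_Ioi c2,
    integral_const_mul, integral_const_mul, integral_exp_mul_Ioi hneg,
    ← intervalIntegral.integral_of_le hx]
  have hne : s + h ≠ 0 := by linarith
  have e1 : ∫ y in (0:ℝ)..x, Real.exp ((s + h) * y) = (Real.exp ((s + h) * x) - 1) / (s + h) := by
    rw [intervalIntegral.integral_comp_mul_left (fun u => Real.exp u) hne, integral_exp]
    simp; field_simp
  rw [e1]
  have e2 : Real.exp (-(s + h) * x) * Real.exp ((s + h) * x) = 1 := by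
    rw [← Real.exp_add]; simp; ring
  have e3 : Real.exp ((s - h) * x) * Real.exp ((h - s) * x) = 1 := by
    rw [← Real.exp_add, ← add_mul]; simp
  have e4 : Real.exp (-x * (s + h)) = Real.exp (-(s + h) * x) := by congr 1; ring
  have d1 : s - h ≠ 0 := by linarith
  rw [e4, ← neg_sub s h, neg_div_neg_eq]
  rw [← neg_sub s h] at e3
  have : Real.exp (-(s + h) * x) / (2 * s) * ((Real.exp ((s + h) * x) - 1) / (s + h)) +
      Real.exp ((s - h) * x) / (2 * s) * (Real.exp (-(s - h) * x) / (s - h)) =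
      1 / (2 * s) * ((Real.exp (-(s + h) * x) * Real.exp ((s + h) * x) - Real.exp (-(s + h) * x))
        / (s + h) + (Real.exp ((s - h) * x) * Real.exp (-(s - h) * x)) / (s - h)) := by ring
  rw [this, e2, e3]

lemma kB (s h x c : ℝ) (hsh : h < s) :
    IntegrableOn (fun y => Real.exp (-h * (x - y)) * (Real.exp (-s * (x + y)) / c))
      (Set.Ioi 0) ∧
    ∫ y in Set.Ioi (0:ℝ), Real.exp (-h * (x - y)) * (Real.exp (-s * (x + y)) / c) =
      Real.exp (-x * (s + h)) / c / (s - h) := by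
  have hneg : h - s < 0 := by linarith
  have hE : ∀ y, Real.exp (-h * (x - y)) * (Real.exp (-s * (x + y)) / c) =
      Real.exp (-x * (s + h)) / c * Real.exp ((h - s) * y) := by
    intro y
    rw [div_mul_eq_mul_div, ← Real.exp_add, ← mul_div_assoc, ← Real.exp_add]
    congr 2; ring
  simp only [hE]
  refine ⟨(integrableOn_exp_mul_Ioi hneg 0).const_mul _, ?_⟩
  rw [integral_const_mul, integral_exp_mul_Ioi hneg, ← neg_sub s h, neg_div_neg_eq]
  simp; field_simp

lemma int3 (a b c : ℝ → ℝ) (ha : IntegrableOn a (Set.Ioi 0)) (hb : IntegrableOn b (Set.Ioi 0))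
    (hc : IntegrableOn c (Set.Ioi 0)) : ∫ t in Set.Ioi (0:ℝ), (a t - b t + c t) =
    (∫ t in Set.Ioi (0:ℝ), a t) - (∫ t in Set.Ioi (0:ℝ), b t) + ∫ t in Set.Ioi (0:ℝ), c t := by
  have h := integral_add (ha.sub hb) hc
  simp only [Pi.sub_apply] at h
  rw [h, integral_sub ha hb]

lemma main_aux (s h c₀ x : ℝ) (hh : 0 ≤ h) (hsh : h < s) (hc : 0 ≤ c₀) (hx : 0 ≤ x) :
    ∫ t in Set.Ioi (0:ℝ), ∫ y in Set.Ioi (0:ℝ),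
      Real.exp (-h * (x - y)) * (Real.exp (-s ^ 2 * t) * p0 c₀ t x y) =
    1 / (2 * s) * ((1 - Real.exp (-x * (s + h))) / (s + h) + 1 / (s - h))
      - Real.exp (-x * (s + h)) / (2 * s) / (s - h)
      + Real.exp (-x * (s + h)) / (c₀ + s) / (s - h) := by
  have hs : 0 < s := by linarith
  let fA : ℝ → ℝ → ℝ := fun t y => Real.exp (-h * (x - y)) * (Real.exp (-s ^ 2 * t) * g t (x - y))
  let fB : ℝ → ℝ → ℝ := fun t y => Real.exp (-h * (x - y)) * (Real.exp (-s ^ 2 * t) * g t (x + y))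
  let fC : ℝ → ℝ → ℝ := fun t y => Real.exp (-h * (x - y)) * (Real.exp (-s ^ 2 * t) *
    ∫ w in Set.Ioi (0 : ℝ), Real.exp (-c₀ * w) * ((w + x + y) / t) * g t (w + x + y))
  have hne : ∀ᵐ y ∂(volume.restrict (Set.Ioi (0:ℝ))), y ≠ x :=
    ae_restrict_of_ae (by simp [ae_iff])
  have lA : ∀ᵐ y ∂(volume.restrict (Set.Ioi (0:ℝ))),
      IntegrableOn (fun t => fA t y) (Set.Ioi 0) ∧ ∫ t in Set.Ioi (0:ℝ), fA t y =
      Real.exp (-h * (x - y)) * (Real.exp (-s * |x - y|) / (2 * s)) := by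
    filter_upwards [hne] with y hy
    have hg : ∀ t, g t (x - y) = g t |x - y| := fun t => by simp [g]
    obtain ⟨h1, h2⟩ := lapA s |x - y| hs (abs_pos.2 (sub_ne_zero.2 hy.symm))
    simp only [fA, hg]
    exact ⟨h1.const_mul _, by rw [integral_const_mul, h2]⟩
  have lB : ∀ᵐ y ∂(volume.restrict (Set.Ioi (0:ℝ))),
      IntegrableOn (fun t => fB t y) (Set.Ioi 0) ∧ ∫ t in Set.Ioi (0:ℝ), fB t y =
      Real.exp (-h * (x - y)) * (Real.exp (-s * (x + y)) / (2 * s)) := by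
    filter_upwards [ae_restrict_mem measurableSet_Ioi] with y hy
    obtain ⟨h1, h2⟩ := lapA s (x + y) hs (add_pos_of_nonneg_of_pos hx hy)
    simp only [fB]
    exact ⟨h1.const_mul _, by rw [integral_const_mul, h2]⟩
  have lC : ∀ᵐ y ∂(volume.restrict (Set.Ioi (0:ℝ))),
      IntegrableOn (fun t => fC t y) (Set.Ioi 0) ∧ ∫ t in Set.Ioi (0:ℝ), fC t y =
      Real.exp (-h * (x - y)) * (Real.exp (-s * (x + y)) / (c₀ + s)) := by
    filter_upwards [ae_restrict_mem measurableSet_Ioi] with y hy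
    obtain ⟨h1, h2⟩ := lapQ s c₀ x y hs hc hx hy
    simp only [fC]
    exact ⟨h1.const_mul _, by rw [integral_const_mul, h2]⟩
  obtain ⟨kA1, kA2⟩ := kA s h x hh hsh hx
  obtain ⟨kB1, kB2⟩ := kB s h x (2 * s) hsh
  obtain ⟨kC1, kC2⟩ := kB s h x (c₀ + s) hsh
  have pA : Integrable (Function.uncurry fA) _ := prodInt fA _ (by
      have := g_meas2 (α := ℝ × ℝ) (a := fun p => p.1) (b := fun p => x - p.2)
        (by fun_prop) (by fun_prop)
      unfold Function.uncurry
      fun_prop) (fun t _ y _ => mul_nonneg (Real.exp_pos _).le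
        (mul_nonneg (Real.exp_pos _).le (g_nonneg _ _))) lA kA1
  have pB : Integrable (Function.uncurry fB) _ := prodInt fB _ (by
      have := g_meas2 (α := ℝ × ℝ) (a := fun p => p.1) (b := fun p => x + p.2)
        (by fun_prop) (by fun_prop)
      unfold Function.uncurry
      fun_prop) (fun t _ y _ => mul_nonneg (Real.exp_pos _).le
        (mul_nonneg (Real.exp_pos _).le (g_nonneg _ _))) lB kB1
  have pC : Integrable (Function.uncurry fC) _ := prodInt fC _ (by
      have := Q_meas c₀ x
      unfold Function.uncurry
      fun_prop) (fun t ht y hy => mul_nonneg (Real.exp_pos _).le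
        (mul_nonneg (Real.exp_pos _).le (setIntegral_nonneg measurableSet_Ioi fun w hw => by
          have := g_nonneg t (w + x + y)
          have hw : 0 < w := hw
          positivity))) lC kC1
  have hsum : ∀ t y, Real.exp (-h * (x - y)) * (Real.exp (-s ^ 2 * t) * p0 c₀ t x y) =
      fA t y - fB t y + fC t y := by
    intro t y; simp only [fA, fB, fC, p0]; ring
  simp only [hsum]
  rw [integral_integral_swap (f := fun t y => fA t y - fB t y + fC t y) ((pA.sub pB).add pC)]
  have : ∀ᵐ y ∂(volume.restrict (Set.Ioi (0:ℝ))),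
      ∫ t in Set.Ioi (0:ℝ), (fA t y - fB t y + fC t y) =
      Real.exp (-h * (x - y)) * (Real.exp (-s * |x - y|) / (2 * s)) -
      Real.exp (-h * (x - y)) * (Real.exp (-s * (x + y)) / (2 * s)) +
      Real.exp (-h * (x - y)) * (Real.exp (-s * (x + y)) / (c₀ + s)) := by
    filter_upwards [lA, lB, lC] with y hA hB hC
    rw [int3 _ _ _ hA.1 hB.1 hC.1, hA.2, hB.2, hC.2]
  rw [integral_congr_ae this, int3 _ _ _ kA1 kB1 kC1, kA2, kB2, kC2]

/-- the Laplace transform in time of `u(t,x)`, with `η = μ²/4`: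
`∫₀^∞ e^{-λt} u(t,x) dt
  = 1/λ - (1/λ)(1 - (√(λ+η)+√η)/(c₀+√(λ+η))) e^{-x(√(λ+η)+√η)}`. -/
theorem stmt6 (μ c₀ : ℝ) (hμ : 0 ≤ μ) (hc : 0 ≤ c₀) (lam x : ℝ) (hlam : 0 < lam)
    (hx : 0 ≤ x) :
    ∫ t in Set.Ioi (0 : ℝ), Real.exp (-lam * t) * uFun μ c₀ t x
      = 1 / lam - 1 / lam *
          (1 - (Real.sqrt (lam + μ ^ 2 / 4) + Real.sqrt (μ ^ 2 / 4)) /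
            (c₀ + Real.sqrt (lam + μ ^ 2 / 4))) *
          Real.exp (-x * (Real.sqrt (lam + μ ^ 2 / 4) + Real.sqrt (μ ^ 2 / 4))) := by
  have hmu : √(μ ^ 2 / 4) = μ / 2 := by
    rw [show μ ^ 2 / 4 = (μ / 2) ^ 2 by ring]
    exact Real.sqrt_sq (by linarith)
  have hpos : 0 < lam + μ ^ 2 / 4 := by positivity
  set s := √(lam + μ ^ 2 / 4) with hsdef
  have hs2 : s ^ 2 = lam + μ ^ 2 / 4 := Real.sq_sqrt hpos.le
  have hs : 0 < s := Real.sqrt_pos.2 hpos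
  have hsh : μ / 2 < s := by nlinarith
  rw [hmu]
  have hL : ∀ t, Real.exp (-lam * t) * uFun μ c₀ t x = ∫ y in Set.Ioi (0:ℝ),
      Real.exp (-(μ / 2) * (x - y)) * (Real.exp (-s ^ 2 * t) * p0 c₀ t x y) := by
    intro t
    rw [uFun, ← integral_const_mul]
    congr 1
    ext y
    rw [mKer, ← mul_assoc, ← mul_assoc, ← Real.exp_add, ← Real.exp_add, hs2]
    congr 2
    ring
  simp only [hL]
  rw [main_aux s (μ / 2) c₀ x (by linarith) hsh hc hx]
  have hl : lam = (s - μ / 2) * (s + μ / 2) := by nlinarith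
  generalize μ / 2 = h at *
  generalize Real.exp (-x * (s + h)) = E
  have d1 : s - h ≠ 0 := by linarith
  have d2 : s + h ≠ 0 := by
    intro h0
    rw [h0, mul_zero] at hl
    linarith
  have d3 : c₀ + s ≠ 0 := by linarith
  rw [hl]
  field_simp
  ring
end
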